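/- arXiv:2108.11132 — 5 statements merged into one kernel-verified Lean document; each statement's English description precedes it below -/
import Mathlib

section
/- Let Q be a quasi-polynomial with minimal period ρ₀. Then Q has the GCD-property with respect to the period ρ₀ if and only if there exists a positive integer k such that Q has the GCD-property with respect to the period kρ₀. -/
open Pointwise MeasureTheory
open scoped RealInnerProductSpace

noncomputable section

/-- Cast an integer vector to a real vector. -/
def castVec {d : ℕ} (x : Fin d → ℤ) : Fin d → ℝ := fun i => (x i : ℝ)

/-- Cast a rational vector to a real vector. -/
def ratVec {d : ℕ} (c : Fin d → ℚ) : Fin d → ℝ := fun i => (c i : ℝ)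

/-- `den(c)`: the lcm of the denominators of the coordinates of a rational vector. -/
def denv {d : ℕ} (c : Fin d → ℚ) : ℕ := Finset.univ.lcm fun i => (c i).den

/-- The number of lattice points in a subset of `ℝ^d`. -/
def latCount {d : ℕ} (S : Set (Fin d → ℝ)) : ℕ := {x : Fin d → ℤ | castVec x ∈ S}.ncard

/-- A lattice polytope: the convex hull of a nonempty finite set of integer points. -/
def IsLatticePolytope {d : ℕ} (P : Set (Fin d → ℝ)) : Prop :=
  ∃ V : Finset (Fin d → ℤ), V.Nonempty ∧ P = convexHull ℝ (castVec '' (V : Set (Fin d → ℤ)))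

/-- The zonotope spanned by a finite set of integer vectors. -/
def zonotopeF {d : ℕ} (U : Finset (Fin d → ℤ)) : Set (Fin d → ℝ) :=
  {x | ∃ lam : (Fin d → ℤ) → ℝ, (∀ u, lam u ∈ Set.Icc (0 : ℝ) 1) ∧
    x = ∑ u ∈ U, lam u • castVec u}

/-- The zonotope spanned by integer vectors `u 0, …, u (n-1)`. -/
def zonotopeZ {d n : ℕ} (u : Fin n → Fin d → ℤ) : Set (Fin d → ℝ) :=
  {x | ∃ lam : Fin n → ℝ, (∀ i, lam i ∈ Set.Icc (0 : ℝ) 1) ∧ x = ∑ i, lam i • castVec (u i)}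

/-- The zonotope spanned by real vectors `u 0, …, u (n-1)`. -/
def zonotopeR {d n : ℕ} (u : Fin n → Fin d → ℝ) : Set (Fin d → ℝ) :=
  {x | ∃ lam : Fin n → ℝ, (∀ i, lam i ∈ Set.Icc (0 : ℝ) 1) ∧ x = ∑ i, lam i • u i}

/-- A zonotope: a translate of the Minkowski sum of finitely many segments `[0, uᵢ]`. -/
def IsZonotope {d : ℕ} (P : Set (Fin d → ℝ)) : Prop :=
  ∃ (n : ℕ) (u : Fin n → Fin d → ℝ) (v : Fin d → ℝ), P = v +ᵥ zonotopeR u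

/-- A set is centrally symmetric if it is a translate of its negation. -/
def CentrallySymmetric {d : ℕ} (P : Set (Fin d → ℝ)) : Prop :=
  ∃ v : Fin d → ℝ, P = v +ᵥ (-P)

/-- `f` is a family of constituents of `L` with respect to the period `ρ`. -/
def IsConstituents (L : ℕ → ℚ) (ρ : ℕ) (f : ℕ → Polynomial ℚ) : Prop :=
  ∀ t : ℕ, 0 < t → L t = (f (t % ρ)).eval (t : ℚ)

/-- `ρ` is a period of the quasi-polynomial `L`. -/
def IsPeriodOf (ρ : ℕ) (L : ℕ → ℚ) : Prop := 0 < ρ ∧ ∃ f, IsConstituents L ρ f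

/-- `ρ₀` is the minimal period of the quasi-polynomial `L`. -/
def IsMinimalPeriodOf (ρ₀ : ℕ) (L : ℕ → ℚ) : Prop :=
  IsPeriodOf ρ₀ L ∧ ∀ ρ : ℕ, IsPeriodOf ρ L → ρ₀ ≤ ρ

/-- GCD-property with respect to the period `ρ`: constituents with equal
`gcd(ρ, ·)` coincide. -/
def GCDProperty (L : ℕ → ℚ) (ρ : ℕ) : Prop :=
  ∀ f : ℕ → Polynomial ℚ, IsConstituents L ρ f →
    ∀ k ℓ : ℕ, Nat.gcd ρ k = Nat.gcd ρ ℓ → f (k % ρ) = f (ℓ % ρ)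

/-- Symmetry with respect to the period `ρ`: `f_k = f_{ρ-k}` for `0 ≤ k ≤ ρ`. -/
def SymmetricQP (L : ℕ → ℚ) (ρ : ℕ) : Prop :=
  ∀ f : ℕ → Polynomial ℚ, IsConstituents L ρ f →
    ∀ k : ℕ, k ≤ ρ → f (k % ρ) = f ((ρ - k) % ρ)

/-- The Ehrhart counting function `t ↦ #(t(c + P) ∩ ℤ^d)` of the translate `c + P`. -/
def ehr {d : ℕ} (P : Set (Fin d → ℝ)) (c : Fin d → ℚ) : ℕ → ℚ :=
  fun t => (latCount ((t : ℝ) • (ratVec c +ᵥ P)) : ℚ)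

/-- The dimension of a polytope: the dimension of the direction of its affine hull. -/
def polyDim {d : ℕ} (P : Set (Fin d → ℝ)) : ℕ := Module.finrank ℝ (affineSpan ℝ P).direction

/-- `r` is the relative volume of `P` (of dimension `m`): with respect to any lattice
point `v₀` of `P` and any `ℤ`-basis `b` of the lattice `aff₀(P) ∩ ℤ^d`, `r` is the
Lebesgue measure of `P` in the coordinates determined by `v₀` and `b`. -/
def IsRelVolOf {d : ℕ} (P : Set (Fin d → ℝ)) (m : ℕ) (r : ℝ) : Prop :=
  ∀ (v₀ : Fin d → ℤ) (b : Fin m → Fin d → ℤ),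
    castVec v₀ ∈ P → LinearIndependent ℤ b →
    (∀ x : Fin d → ℤ,
      castVec x ∈ (affineSpan ℝ P).direction ↔ x ∈ Submodule.span ℤ (Set.range b)) →
    r = (volume {lam : Fin m → ℝ | castVec v₀ + ∑ i, lam i • castVec (b i) ∈ P}).toReal

/-- The (real casts of the) elements of `W` are linearly independent over `ℝ`. -/
def LinIndepF {d : ℕ} (W : Finset (Fin d → ℤ)) : Prop :=
  LinearIndependent ℝ fun w : ↥W => castVec w.1

/-- Almost locally constant: locally constant outside a discrete point set. -/
def AlmostLocallyConstant (f : ℝ → ℝ) : Prop :=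
  ∃ D : Set ℝ, DiscreteTopology D ∧ IsLocallyConstant fun x : ↥(Dᶜ) => f ↑x

/-- Almost constant: constant outside a discrete point set. -/
def AlmostConstant (f : ℝ → ℝ) : Prop :=
  ∃ D : Set ℝ, DiscreteTopology D ∧ ∃ r : ℝ, ∀ x ∉ D, f x = r

/-- The face of `P` in the outer normal direction `v`. -/
def normalFace {d : ℕ} (P : Set (EuclideanSpace ℝ (Fin d)))
    (v : EuclideanSpace ℝ (Fin d)) : Set (EuclideanSpace ℝ (Fin d)) :=
  {x | x ∈ P ∧ ∀ y ∈ P, ⟪y, v⟫ ≤ ⟪x, v⟫}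

/-- `F` is a facet of the `d`-polytope `P`: an exposed face of dimension `d - 1`. -/
def IsFacetOf {d : ℕ} (F P : Set (EuclideanSpace ℝ (Fin d))) : Prop :=
  (∃ v : EuclideanSpace ℝ (Fin d), v ≠ 0 ∧ F = normalFace P v) ∧
  Module.finrank ℝ (affineSpan ℝ F).direction = d - 1

/-- If `a` and `b` have the same gcd with `n`, then they differ modulo `n` by a factor that can be
chosen coprime to any given nonzero multiple `m` of `n`. -/
theorem exists_coprime_mul_modEq_of_gcd_eq {n m a b : ℕ} (hm : m ≠ 0) (hnm : n ∣ m)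
    (h : n.gcd a = n.gcd b) : ∃ u : ℕ, m.Coprime u ∧ u * a ≡ b [MOD n] := by
  have : NeZero m := ⟨hm⟩
  have hn : 0 < n := Nat.pos_of_dvd_of_pos hnm (Nat.pos_of_ne_zero hm)
  have hga : 0 < n.gcd a := Nat.gcd_pos_of_pos_left a hn
  have hgb : 0 < n.gcd b := h ▸ hga
  have ha := (Nat.coprime_div_gcd_div_gcd hga).symm
  have hb := (Nat.coprime_div_gcd_div_gcd hgb).symm
  rw [← h] at hb
  have hdvd : n / n.gcd a ∣ m := (Nat.div_dvd_of_dvd (Nat.gcd_dvd_left n a)).trans hnm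
  obtain ⟨u, hu⟩ := ZMod.unitsMap_surjective hdvd
    (ZMod.unitOfCoprime _ hb * (ZMod.unitOfCoprime _ ha)⁻¹)
  refine ⟨(u : ZMod m).val, (ZMod.val_coe_unit_coprime u).symm, ?_⟩
  have key : (u : ZMod m).val * (a / n.gcd a) ≡ b / n.gcd a [MOD n / n.gcd a] := by
    rw [← ZMod.natCast_eq_natCast_iff]
    have hu' := congrArg Units.val (eq_mul_inv_iff_mul_eq.mp hu)
    rw [Units.val_mul, ZMod.unitsMap_val, ZMod.coe_unitOfCoprime, ZMod.coe_unitOfCoprime] at hu'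
    rwa [Nat.cast_mul, ZMod.natCast_val]
  have := key.mul_left' (n.gcd a)
  rwa [mul_left_comm, Nat.mul_div_cancel' (Nat.gcd_dvd_right n a),
    Nat.mul_div_cancel' (Nat.gcd_dvd_left n a), h,
    Nat.mul_div_cancel' (Nat.gcd_dvd_right n b)] at this

/-- Constituents with respect to a period `ρ` are also constituents with respect to every
multiple of `ρ`, when repeated periodically. -/
theorem IsConstituents.of_dvd {L : ℕ → ℚ} {ρ σ : ℕ} {f : ℕ → Polynomial ℚ}
    (hf : IsConstituents L ρ f) (h : ρ ∣ σ) : IsConstituents L σ fun t => f (t % ρ) := by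
  intro t ht
  simp only [Nat.mod_mod_of_dvd t h]
  exact hf t ht

/-- The GCD-property descends along divisibility of periods. -/
theorem GCDProperty.of_dvd {L : ℕ → ℚ} {ρ σ : ℕ} (hL : GCDProperty L σ) (hσ : σ ≠ 0)
    (h : ρ ∣ σ) : GCDProperty L ρ := by
  intro f hf a b hab
  obtain ⟨u, hu, hmod⟩ := exists_coprime_mul_modEq_of_gcd_eq hσ h hab
  have := hL _ (hf.of_dvd h) (u * a) a (hu.symm.gcd_mul_left_cancel_right a)
  simp only [Nat.mod_mod_of_dvd _ h] at this
  rw [← this, hmod]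

/-- A quasi-polynomial `Q` with minimal period `ρ₀` has the GCD-property
with respect to `ρ₀` iff it has the GCD-property with respect to `k·ρ₀` for some
positive integer `k`. -/
theorem gcd_property_iff_gcd_property_mul (Q : ℕ → ℚ) (ρ₀ : ℕ)
    (hmin : IsMinimalPeriodOf ρ₀ Q) :
    GCDProperty Q ρ₀ ↔ ∃ k : ℕ, 0 < k ∧ GCDProperty Q (k * ρ₀) := by
  constructor
  · intro h
    exact ⟨1, one_pos, by rwa [one_mul]⟩
  · rintro ⟨k, hk, h⟩
    exact h.of_dvd (Nat.mul_pos hk hmin.1.1).ne' (Dvd.intro_left k rfl)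
end
end

section
/- Let Q be a quasi-polynomial with minimal period ρ₀ and let k be a positive integer. Then Q is symmetric with respect to the period ρ₀ if and only if Q is symmetric with respect to the period kρ₀. -/
open Pointwise MeasureTheory
open scoped RealInnerProductSpace

noncomputable section

/-- Constituents with respect to a period `ρ` are unique on residues modulo `ρ`. -/
theorem IsConstituents.unique {L : ℕ → ℚ} {ρ : ℕ} {f g : ℕ → Polynomial ℚ} (hρ : 0 < ρ)
    (hf : IsConstituents L ρ f) (hg : IsConstituents L ρ g) (t : ℕ) :
    f (t % ρ) = g (t % ρ) := by
  apply Polynomial.eq_of_infinite_eval_eq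
  apply (Set.infinite_range_of_injective (f := fun n : ℕ => ((t + ρ * (n + 1) : ℕ) : ℚ)) ?_).mono
  · rintro _ ⟨n, rfl⟩
    have hpos : 0 < t + ρ * (n + 1) := by positivity
    have h := (hf _ hpos).symm.trans (hg _ hpos)
    simpa only [Nat.add_mul_mod_self_left, Set.mem_ofPred_eq] using h
  · intro m n h
    have h' : t + ρ * (m + 1) = t + ρ * (n + 1) := Nat.cast_injective h
    exact Nat.succ_injective (Nat.eq_of_mul_eq_mul_left hρ (Nat.add_left_cancel h'))

/-- Negation modulo `ρ` may be computed from any multiple of `ρ`. -/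
theorem mul_sub_mod_eq_sub_mod_mod {ρ k j : ℕ} (hρ : 0 < ρ) (hj : j ≤ k * ρ) :
    (k * ρ - j) % ρ = (ρ - j % ρ) % ρ := by
  have hr : j % ρ ≤ ρ := (Nat.mod_lt j hρ).le
  refine Nat.ModEq.add_right_cancel (c := j) (d := j % ρ) (Nat.mod_modEq j ρ).symm ?_
  rw [Nat.sub_add_cancel hj, Nat.sub_add_cancel hr]
  simp [Nat.ModEq]

/-- A quasi-polynomial `Q` with minimal period `ρ₀` is symmetric with
respect to `ρ₀` iff it is symmetric with respect to `k·ρ₀`, for any positive integer `k`. -/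
theorem symmetric_iff_symmetric_mul (Q : ℕ → ℚ) (ρ₀ k : ℕ)
    (hmin : IsMinimalPeriodOf ρ₀ Q) (hk : 0 < k) :
    SymmetricQP Q ρ₀ ↔ SymmetricQP Q (k * ρ₀) := by
  obtain ⟨⟨hρ, f₀, hf₀⟩, -⟩ := hmin
  have hdvd : ρ₀ ∣ k * ρ₀ := Dvd.intro_left k rfl
  constructor
  · intro hsymm g hg j hj
    have hgf (t : ℕ) : g (t % (k * ρ₀)) = f₀ (t % ρ₀) := by
      rw [hg.unique (Nat.mul_pos hk hρ) (hf₀.of_dvd hdvd) t, Nat.mod_mod_of_dvd t hdvd]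
    have h := hsymm f₀ hf₀ (j % ρ₀) (Nat.mod_lt j hρ).le
    rw [hgf, hgf, mul_sub_mod_eq_sub_mod_mod hρ hj, ← h, Nat.mod_mod]
  · intro hsymm f hf j hj
    have hjk : j ≤ k * ρ₀ := hj.trans (Nat.le_mul_of_pos_left ρ₀ hk)
    have h := hsymm _ (hf.of_dvd hdvd) j hjk
    simp only [Nat.mod_mod_of_dvd _ hdvd] at h
    rw [h, mul_sub_mod_eq_sub_mod_mod hρ hjk,
      ← mul_sub_mod_eq_sub_mod_mod (k := 1) hρ (by rwa [one_mul]), one_mul]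
end
end

section
/- Let U ⊂ ℤ^d be a finite set of integer vectors, let c ∈ ℚ^d with ρ₀ = den(c), and let W ⊆ U be a linearly independent subset. Then there exists a positive divisor m of ρ₀ such that for every positive integer t, the affine subspace tc + span_ℝ(W) contains a point of ℤ^d if and only if m divides t. In particular, whether (tc + span_ℝ(W)) ∩ ℤ^d ≠ ∅ depends only on gcd(t, ρ₀). -/
open Pointwise MeasureTheory
open scoped RealInnerProductSpace

noncomputable section

/-- The subgroup `ℤ^d + V` of `ℝ^d`. -/
def latticeSup {d : ℕ} (V : Submodule ℝ (Fin d → ℝ)) : AddSubgroup (Fin d → ℝ) :=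
  ((Int.castAddHom ℝ).compLeft (Fin d)).range ⊔ V.toAddSubgroup

theorem exists_castVec_mem_vadd_iff {d : ℕ} (V : Submodule ℝ (Fin d → ℝ)) (p : Fin d → ℝ) :
    (∃ x : Fin d → ℤ, castVec x ∈ p +ᵥ (V : Set (Fin d → ℝ))) ↔ p ∈ latticeSup V := by
  rw [latticeSup, AddSubgroup.mem_sup]
  constructor
  · rintro ⟨x, v, hv, hx⟩
    refine ⟨castVec x, ⟨x, rfl⟩, -v, V.neg_mem hv, ?_⟩
    rw [← hx]
    simp
  · rintro ⟨_, ⟨x, rfl⟩, v, hv, rfl⟩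
    refine ⟨x, -v, V.neg_mem hv, ?_⟩
    simp only [vadd_eq_add, add_neg_cancel_right]
    rfl

theorem denv_ne_zero {d : ℕ} (c : Fin d → ℚ) : denv c ≠ 0 := by
  simp [denv, Finset.lcm_eq_zero_iff]

theorem exists_castVec_eq_denv_smul {d : ℕ} (c : Fin d → ℚ) :
    ∃ x : Fin d → ℤ, castVec x = (denv c : ℝ) • ratVec c := by
  have key (i : Fin d) : ∃ n : ℤ, (n : ℝ) = (denv c : ℝ) * (c i : ℝ) := by
    obtain ⟨k, hk⟩ : (c i).den ∣ denv c := Finset.dvd_lcm (Finset.mem_univ i)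
    refine ⟨k * (c i).num, ?_⟩
    have h : ((c i).den : ℝ) * (c i : ℝ) = (c i).num := mod_cast Rat.den_mul_eq_num (c i)
    rw [hk]
    push_cast
    linear_combination -(k : ℝ) * h
  choose x hx using key
  exact ⟨x, funext hx⟩

/-- For a linearly independent subset `W ⊆ U` of integer vectors and a
rational vector `c` with `ρ₀ = den(c)`, there is a positive divisor `m` of `ρ₀` such
that for every positive integer `t`, `(tc + span_ℝ(W)) ∩ ℤ^d ≠ ∅` iff `m ∣ t`; in
particular nonemptiness depends only on `gcd(t, ρ₀)`. -/
theorem exists_divisor_characterizing_nonempty_intersection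
    (d : ℕ) (U : Finset (Fin d → ℤ)) (c : Fin d → ℚ)
    (W : Finset (Fin d → ℤ)) (hWU : W ⊆ U) (hW : LinIndepF W) :
    ∃ m : ℕ, 0 < m ∧ m ∣ denv c ∧
      (∀ t : ℕ, 0 < t →
        ((∃ x : Fin d → ℤ, castVec x ∈ ((t : ℝ) • ratVec c) +ᵥ
            (Submodule.span ℝ (castVec '' (W : Set (Fin d → ℤ))) : Set (Fin d → ℝ))) ↔
          m ∣ t)) ∧
      (∀ t s : ℕ, 0 < t → 0 < s → Nat.gcd t (denv c) = Nat.gcd s (denv c) →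
        ((∃ x : Fin d → ℤ, castVec x ∈ ((t : ℝ) • ratVec c) +ᵥ
            (Submodule.span ℝ (castVec '' (W : Set (Fin d → ℤ))) : Set (Fin d → ℝ))) ↔
         (∃ x : Fin d → ℤ, castVec x ∈ ((s : ℝ) • ratVec c) +ᵥ
            (Submodule.span ℝ (castVec '' (W : Set (Fin d → ℤ))) : Set (Fin d → ℝ))))) := by
  set V := Submodule.span ℝ (castVec '' (W : Set (Fin d → ℤ)))
  let q : (Fin d → ℝ) ⧸ latticeSup V := QuotientAddGroup.mk (ratVec c)
  have key (t : ℕ) : (∃ x : Fin d → ℤ, castVec x ∈ ((t : ℝ) • ratVec c) +ᵥ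
      (V : Set (Fin d → ℝ))) ↔ addOrderOf q ∣ t := by
    rw [exists_castVec_mem_vadd_iff, addOrderOf_dvd_iff_nsmul_eq_zero, Nat.cast_smul_eq_nsmul,
      ← QuotientAddGroup.mk_nsmul, QuotientAddGroup.eq_zero_iff]
  have hdvd : addOrderOf q ∣ denv c := by
    obtain ⟨x, hx⟩ := exists_castVec_eq_denv_smul c
    exact (key _).1 ⟨x, 0, V.zero_mem, by simp [hx]⟩
  refine ⟨addOrderOf q, Nat.pos_of_dvd_of_pos hdvd (Nat.pos_of_ne_zero (denv_ne_zero c)), hdvd,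
    fun t _ => key t, fun t s _ _ hts => ?_⟩
  have hgcd (n : ℕ) : addOrderOf q ∣ n ↔ addOrderOf q ∣ n.gcd (denv c) := by
    simp [Nat.dvd_gcd_iff, hdvd]
  rw [key, key, hgcd t, hgcd s, hts]
end
end

section
/- Let U be a finite set of vectors in ℤ^d and c ∈ ℚ^d, and set ρ₀ = den(c). Then the Ehrhart quasi-polynomial L_{c+Z(U)}(t) = #(t(c+Z(U)) ∩ ℤ^d) of the almost integral zonotope c + Z(U) satisfies the GCD-property with respect to the period ρ₀: whenever gcd(k, ρ₀) = gcd(ℓ, ρ₀), the k-th and ℓ-th constituents of L_{c+Z(U)} coincide. -/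
open Pointwise MeasureTheory
open scoped RealInnerProductSpace

noncomputable section

/-- The Minkowski sum of `P` and the segment `[0, t • u]`. -/
def sweep {V : Type} [AddCommGroup V] [Module ℝ V] (t : ℝ) (u : V) (P : Set V) : Set V :=
  {v | ∃ s ∈ Set.Icc (0 : ℝ) t, v - s • u ∈ P}

/-- The translate by `x` of the `t`-th dilate of the zonotope spanned by the images under `φ`
of the elements of a list. -/
def listZonotope {Λ V : Type} [AddCommGroup Λ] [AddCommGroup V] [Module ℝ V] (φ : Λ →+ V)
    (t : ℝ) (x : V) : List Λ → Set V
  | [] => {x}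
  | u :: l => sweep t (φ u) (listZonotope φ t x l)

section Sweep

variable {V W : Type} [AddCommGroup V] [Module ℝ V] [AddCommGroup W] [Module ℝ W]

lemma Convex.sweep {P : Set V} (hP : Convex ℝ P) (t : ℝ) (u : V) : Convex ℝ (sweep t u P) := by
  rintro v ⟨s, hs, hv⟩ w ⟨r, hr, hw⟩ a b ha hb hab
  refine ⟨a * s + b * r, convex_Icc (0 : ℝ) t hs hr ha hb hab, ?_⟩
  have := hP hv hw ha hb hab
  convert this using 1
  module

lemma sweep_zero_left (u : V) (P : Set V) : sweep 0 u P = P := by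
  ext v
  simp [sweep]

lemma sweep_zero_right {t : ℝ} (ht : 0 ≤ t) (P : Set V) : sweep t 0 P = P := by
  ext v
  constructor
  · rintro ⟨s, -, hv⟩
    simpa using hv
  · intro hv
    exact ⟨0, ⟨le_rfl, ht⟩, by simpa using hv⟩

lemma sweep_add_one {t : ℝ} (ht : 0 ≤ t) (u : V) (P : Set V) :
    sweep (t + 1) u P = sweep 1 u (sweep t u P) := by
  ext v
  constructor
  · rintro ⟨s, ⟨hs0, hs⟩, hv⟩
    rcases le_total s t with h | h
    · exact ⟨0, by simp, s, ⟨hs0, h⟩, by simpa using hv⟩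
    · refine ⟨s - t, ⟨by linarith, by linarith⟩, t, ⟨ht, le_rfl⟩, ?_⟩
      convert hv using 1
      module
  · rintro ⟨s, ⟨hs0, hs⟩, r, ⟨hr0, hr⟩, hv⟩
    refine ⟨s + r, ⟨by linarith, by linarith⟩, ?_⟩
    convert hv using 1
    module

lemma sweep_mono {s t : ℝ} (hst : s ≤ t) (u : V) {P Q : Set V} (hPQ : P ⊆ Q) :
    sweep s u P ⊆ sweep t u Q := by
  rintro v ⟨r, hr, hv⟩
  exact ⟨r, ⟨hr.1, hr.2.trans hst⟩, hPQ hv⟩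

lemma subset_sweep {t : ℝ} (ht : 0 ≤ t) (u : V) (P : Set V) : P ⊆ sweep t u P :=
  fun v hv => ⟨0, ⟨le_rfl, ht⟩, by simpa using hv⟩

lemma image_sweep (f : V →ₗ[ℝ] W) (t : ℝ) (u : V) (P : Set V) :
    f '' sweep t u P = sweep t (f u) (f '' P) := by
  ext w
  constructor
  · rintro ⟨v, ⟨s, hs, hv⟩, rfl⟩
    exact ⟨s, hs, _, hv, by simp⟩
  · rintro ⟨s, hs, v, hv, h⟩
    refine ⟨v + s • u, ⟨s, hs, by simpa using hv⟩, ?_⟩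
    simp [h]

lemma image_mkQ_sweep {t : ℝ} (ht : 0 ≤ t) (u : V) (P : Set V) :
    (ℝ ∙ u).mkQ '' sweep t u P = (ℝ ∙ u).mkQ '' P := by
  rw [image_sweep]
  have : (ℝ ∙ u).mkQ u = 0 := by simp [Submodule.mem_span_singleton_self]
  rw [this, sweep_zero_right ht]

end Sweep

section Contraction

variable {Λ V : Type} [AddCommGroup Λ] [AddCommGroup V] [Module ℝ V]

/-- The map induced by `φ` on the quotients by `u` and by the line through `φ u`. -/
def contraction (φ : Λ →+ V) (u : Λ) :
    Λ ⧸ AddSubgroup.zmultiples u →+ V ⧸ (ℝ ∙ φ u) :=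
  QuotientAddGroup.lift _ ((ℝ ∙ φ u).mkQ.toAddMonoidHom.comp φ) (by
    intro z hz
    obtain ⟨n, rfl⟩ := AddSubgroup.mem_zmultiples_iff.1 hz
    have : (ℝ ∙ φ u).mkQ (φ u) = 0 := by simp [Submodule.mem_span_singleton_self]
    simp only [AddMonoidHom.mem_ker, AddMonoidHom.comp_apply, map_zsmul]
    exact (congrArg (n • ·) this).trans (smul_zero n))

lemma contraction_mk (φ : Λ →+ V) (u z : Λ) :
    contraction φ u (QuotientAddGroup.mk z) = (ℝ ∙ φ u).mkQ (φ z) := rfl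

lemma contraction_mk_mem_image (φ : Λ →+ V) (u z : Λ) (P : Set V) :
    contraction φ u (QuotientAddGroup.mk z) ∈ (ℝ ∙ φ u).mkQ '' P ↔
      ∃ s : ℝ, φ z + s • φ u ∈ P := by
  rw [contraction_mk]
  constructor
  · rintro ⟨v, hv, h⟩
    have h' := (Submodule.Quotient.eq _).1 h
    obtain ⟨s, hs⟩ := Submodule.mem_span_singleton.1 h'
    exact ⟨s, by rw [hs]; simpa using hv⟩
  · rintro ⟨s, hs⟩
    refine ⟨_, hs, (Submodule.Quotient.eq _).2 ?_⟩
    exact Submodule.mem_span_singleton.2 ⟨s, by simp⟩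

lemma ncard_preimage_sweep_one (φ : Λ →+ V) {u : Λ} (hu : φ u ≠ 0) {P : Set V}
    (hP : Convex ℝ P) (hfin : (φ ⁻¹' sweep 1 (φ u) P).Finite) :
    (φ ⁻¹' sweep 1 (φ u) P).ncard =
      (φ ⁻¹' P).ncard + (contraction φ u ⁻¹' ((ℝ ∙ φ u).mkQ '' P)).ncard := by
  have hsub : φ ⁻¹' P ⊆ φ ⁻¹' sweep 1 (φ u) P :=
    Set.preimage_mono (subset_sweep zero_le_one _ _)
  rw [← Set.ncard_sdiff_add_ncard_of_subset hsub hfin, add_comm]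
  congr 1
  refine Set.ncard_congr (fun z _ => QuotientAddGroup.mk z) ?_ ?_ ?_
  · rintro z ⟨⟨s, hs, hz⟩, -⟩
    refine (contraction_mk_mem_image φ u z P).2 ⟨-s, ?_⟩
    convert hz using 1
    module
  · have key : ∀ (z : Λ) (n : ℤ), φ z ∉ P → φ z ∈ sweep 1 (φ u) P → 0 < n →
        φ (z + n • u) ∈ sweep 1 (φ u) P → False := by
      rintro z n hz ⟨r, hr, hr'⟩ hn ⟨s, hs, hs'⟩
      apply hz
      have hn' : (1 : ℝ) ≤ n := by exact_mod_cast hn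
      have hns : 0 ≤ (n : ℝ) - s := by linarith [hs.2]
      rcases hr.1.eq_or_lt with h0 | h0
      · simpa [← h0] using hr'
      have hpos : 0 < (n : ℝ) - s + r := by linarith
      have := hP hr' hs' (a := (n - s) / (n - s + r)) (b := r / (n - s + r))
        (by positivity) (div_nonneg h0.le hpos.le) (by field_simp)
      convert this using 1
      simp only [map_add, map_zsmul, ← Int.cast_smul_eq_zsmul ℝ n]
      match_scalars
      · field_simp
      · field_simp
        ring
    rintro z w ⟨hz, hz'⟩ ⟨hw, hw'⟩ h
    obtain ⟨n, hn⟩ := AddSubgroup.mem_zmultiples_iff.1 (QuotientAddGroup.eq.1 h)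
    have hwz : w = z + n • u := by rw [hn]; abel
    have hzw : z = w + (-n) • u := by rw [neg_smul, hn]; abel
    rcases lt_trichotomy n 0 with hn0 | hn0 | hn0
    · exact (key w (-n) hw' hw (by omega) (by rw [← hzw]; exact hz)).elim
    · simp [hwz, hn0]
    · exact (key z n hz' hz hn0 (by rw [← hwz]; exact hw)).elim
  · intro q hq
    induction q using QuotientAddGroup.induction_on with
    | H z =>
      obtain ⟨s, hs⟩ := (contraction_mk_mem_image φ u z P).1 hq
      have hinj : Function.Injective fun n : ℤ => z + n • u := by
        intro m n h
        have h1 : (m : ℤ) • u = n • u := add_left_cancel h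
        have h2 := congrArg φ h1
        rw [map_zsmul, map_zsmul, ← Int.cast_smul_eq_zsmul ℝ, ← Int.cast_smul_eq_zsmul ℝ] at h2
        exact_mod_cast smul_left_injective ℝ hu h2
      have hJ : {n : ℤ | φ (z + n • u) ∈ sweep 1 (φ u) P}.Finite :=
        Set.Finite.preimage (s := φ ⁻¹' sweep 1 (φ u) P) hinj.injOn hfin
      have hne : {n : ℤ | φ (z + n • u) ∈ sweep 1 (φ u) P}.Nonempty := by
        refine ⟨⌈s⌉, ⌈s⌉ - s, ⟨by linarith [Int.le_ceil s], by linarith [Int.ceil_lt_add_one s]⟩, ?_⟩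
        convert hs using 1
        simp only [map_add, map_zsmul, ← Int.cast_smul_eq_zsmul ℝ ⌈s⌉]
        module
      obtain ⟨n, hn, hmax⟩ := hJ.exists_maximal hne
      refine ⟨z + n • u, ⟨hn, fun hnP => ?_⟩, ?_⟩
      · have hmem : n + 1 ∈ {n : ℤ | φ (z + n • u) ∈ sweep 1 (φ u) P} := by
          refine ⟨1, by simp, ?_⟩
          convert (show φ (z + n • u) ∈ P from hnP) using 1
          simp only [map_add, map_zsmul, add_smul, one_smul]
          abel
        have := hmax hmem (by simp)
        omega
      · refine (QuotientAddGroup.eq.2 ?_)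
        exact AddSubgroup.mem_zmultiples_iff.2 ⟨-n, by simp⟩

lemma ncard_preimage_sweep (φ : Λ →+ V) {u : Λ} (hu : φ u ≠ 0) {P : Set V}
    (hP : Convex ℝ P) (t : ℕ) (hfin : (φ ⁻¹' sweep t (φ u) P).Finite) :
    (φ ⁻¹' sweep t (φ u) P).ncard =
      (φ ⁻¹' P).ncard + t * (contraction φ u ⁻¹' ((ℝ ∙ φ u).mkQ '' P)).ncard := by
  induction t with
  | zero => simp [sweep_zero_left]
  | succ t ih =>
    have ht : (0 : ℝ) ≤ t := t.cast_nonneg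
    rw [Nat.cast_succ, sweep_add_one ht] at hfin ⊢
    rw [ncard_preimage_sweep_one φ hu (hP.sweep _ _) hfin, image_mkQ_sweep ht,
      ih (hfin.subset (Set.preimage_mono (subset_sweep zero_le_one _ _)))]
    ring

end Contraction

section ListZonotope

variable {Λ V : Type} [AddCommGroup Λ] [AddCommGroup V] [Module ℝ V]

lemma convex_listZonotope (φ : Λ →+ V) (t : ℝ) (x : V) (l : List Λ) :
    Convex ℝ (listZonotope φ t x l) := by
  induction l with
  | nil => exact convex_singleton x
  | cons u l ih => exact ih.sweep _ _

lemma listZonotope_mono (φ : Λ →+ V) {s t : ℝ} (hst : s ≤ t) (x : V) (l : List Λ) :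
    listZonotope φ s x l ⊆ listZonotope φ t x l := by
  induction l with
  | nil => exact subset_rfl
  | cons u l ih => exact sweep_mono hst _ ih

lemma image_mkQ_listZonotope (φ : Λ →+ V) (u : Λ) (t : ℝ) (x : V) (l : List Λ) :
    (ℝ ∙ φ u).mkQ '' listZonotope φ t x l =
      listZonotope (contraction φ u) t ((ℝ ∙ φ u).mkQ x) (l.map QuotientAddGroup.mk) := by
  induction l with
  | nil => simp [listZonotope]
  | cons v l ih =>
    simp only [listZonotope, List.map_cons]
    rw [image_sweep, ih, contraction_mk]

/-- Every translate of every zonotope with generators in the image of `φ` has a finite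
preimage under `φ`. -/
def FiniteOnZonotopes (φ : Λ →+ V) : Prop :=
  ∀ (t : ℝ) (x : V) (l : List Λ), (φ ⁻¹' listZonotope φ t x l).Finite

lemma FiniteOnZonotopes.contraction {φ : Λ →+ V} (hφ : FiniteOnZonotopes φ) (u : Λ) :
    FiniteOnZonotopes (contraction φ u) := by
  intro t x' l'
  obtain ⟨x, rfl⟩ := (ℝ ∙ φ u).mkQ_surjective x'
  obtain ⟨l, rfl⟩ := List.map_surjective_iff.2
    (QuotientAddGroup.mk_surjective (s := AddSubgroup.zmultiples u)) l'
  rw [← image_mkQ_listZonotope]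
  refine ((hφ (max t 1) x (u :: l)).image QuotientAddGroup.mk).subset ?_
  intro q hq
  induction q using QuotientAddGroup.induction_on with
  | H z =>
    obtain ⟨s, hs⟩ := (contraction_mk_mem_image φ u z _).1 hq
    refine ⟨z + ⌈s⌉ • u, ⟨⌈s⌉ - s, ⟨by linarith [Int.le_ceil s],
      le_max_of_le_right (by linarith [Int.ceil_lt_add_one s])⟩, ?_⟩, ?_⟩
    · apply listZonotope_mono φ (le_max_left t 1)
      convert hs using 1
      simp only [map_add, map_zsmul, ← Int.cast_smul_eq_zsmul ℝ ⌈s⌉]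
      module
    · exact QuotientAddGroup.eq.2 (AddSubgroup.mem_zmultiples_iff.2 ⟨-⌈s⌉, by simp⟩)

lemma ncard_preimage_listZonotope_cons {φ : Λ →+ V} (hφ : FiniteOnZonotopes φ) {u : Λ}
    (hu : φ u ≠ 0) (t : ℕ) (x : V) (l : List Λ) :
    (φ ⁻¹' listZonotope φ t x (u :: l)).ncard =
      (φ ⁻¹' listZonotope φ t x l).ncard +
        t * (contraction φ u ⁻¹' listZonotope (contraction φ u) t ((ℝ ∙ φ u).mkQ x)
          (l.map QuotientAddGroup.mk)).ncard := by
  rw [← image_mkQ_listZonotope]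
  exact ncard_preimage_sweep φ hu (convex_listZonotope φ t x l) t (hφ t x (u :: l))

lemma listZonotope_cons_of_eq_zero {φ : Λ →+ V} {u : Λ} (hu : φ u = 0) (t : ℕ) (x : V)
    (l : List Λ) : listZonotope φ t x (u :: l) = listZonotope φ t x l := by
  rw [listZonotope, hu, sweep_zero_right t.cast_nonneg]

end ListZonotope

theorem exists_polynomial_ncard_preimage_listZonotope (n : ℕ) :
    ∀ {Λ V : Type} [AddCommGroup Λ] [AddCommGroup V] [Module ℝ V] {φ : Λ →+ V},
      FiniteOnZonotopes φ → ∀ (l : List Λ), l.length = n → ∀ x : V,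
        ∃ p : Polynomial ℚ, ∀ t : ℕ,
          ((φ ⁻¹' listZonotope φ t x l).ncard : ℚ) = p.eval (t : ℚ) := by
  induction n with
  | zero =>
    intro Λ V _ _ _ φ hφ l hl x
    obtain rfl := List.length_eq_zero_iff.1 hl
    exact ⟨Polynomial.C ((φ ⁻¹' {x}).ncard : ℚ), fun t => by simp [listZonotope]⟩
  | succ n ih =>
    intro Λ V _ _ _ φ hφ l hl x
    obtain ⟨u, l, rfl⟩ := List.exists_cons_of_length_eq_add_one hl
    have hl' : l.length = n := by simpa using hl
    obtain ⟨p, hp⟩ := ih hφ l hl' x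
    by_cases hu : φ u = 0
    · exact ⟨p, fun t => by rw [listZonotope_cons_of_eq_zero hu, hp]⟩
    · obtain ⟨q, hq⟩ := ih (hφ.contraction u) (l.map QuotientAddGroup.mk)
        (by simpa using hl') ((ℝ ∙ φ u).mkQ x)
      refine ⟨p + Polynomial.X * q, fun t => ?_⟩
      rw [ncard_preimage_listZonotope_cons hφ hu]
      push_cast
      rw [hp, hq, Polynomial.eval_add, Polynomial.eval_mul, Polynomial.eval_X]

/-- The number of lattice points in a translate of a zonotope depends only on which subspaces
have a parallel through the translation vector that meets the lattice. -/
theorem ncard_preimage_listZonotope_congr (n : ℕ) :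
    ∀ {Λ V : Type} [AddCommGroup Λ] [AddCommGroup V] [Module ℝ V] {φ : Λ →+ V},
      FiniteOnZonotopes φ → ∀ (l : List Λ), l.length = n → ∀ x y : V,
        (∀ S : Submodule ℝ V, (∃ z, x - φ z ∈ S) ↔ ∃ z, y - φ z ∈ S) → ∀ t : ℕ,
          (φ ⁻¹' listZonotope φ t x l).ncard = (φ ⁻¹' listZonotope φ t y l).ncard := by
  induction n with
  | zero =>
    intro Λ V _ _ _ φ hφ l hl x y hxy t
    obtain rfl := List.length_eq_zero_iff.1 hl
    have h0 := hxy ⊥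
    simp only [Submodule.mem_bot, sub_eq_zero] at h0
    simp only [listZonotope]
    by_cases hx : ∃ z, x = φ z
    · obtain ⟨w, rfl⟩ := h0.1 hx
      obtain ⟨z, rfl⟩ := hx
      refine Set.ncard_congr (fun a _ => a + (w - z)) ?_ ?_ ?_
      · intro a ha
        have : φ a = φ z := ha
        simp [this]
      · intro a b _ _ h
        exact add_right_cancel h
      · intro b hb
        have : φ b = φ w := hb
        exact ⟨b - (w - z), by simp [this], by simp⟩
    · have hx' : φ ⁻¹' {x} = ∅ :=
        Set.eq_empty_of_forall_notMem fun z hz => hx ⟨z, (Eq.symm hz)⟩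
      have hy' : φ ⁻¹' {y} = ∅ :=
        Set.eq_empty_of_forall_notMem fun z hz => hx (h0.2 ⟨z, (Eq.symm hz)⟩)
      rw [hx', hy']
  | succ n ih =>
    intro Λ V _ _ _ φ hφ l hl x y hxy t
    obtain ⟨u, l, rfl⟩ := List.exists_cons_of_length_eq_add_one hl
    have hl' : l.length = n := by simpa using hl
    by_cases hu : φ u = 0
    · rw [listZonotope_cons_of_eq_zero hu, listZonotope_cons_of_eq_zero hu,
        ih hφ l hl' x y hxy]
    · rw [ncard_preimage_listZonotope_cons hφ hu, ncard_preimage_listZonotope_cons hφ hu,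
        ih hφ l hl' x y hxy]
      congr 2
      refine ih (hφ.contraction u) _ (by simpa using hl') _ _ (fun S => ?_) t
      have h := hxy (S.comap (ℝ ∙ φ u).mkQ)
      simp only [Submodule.mem_comap, map_sub] at h
      rw [(QuotientAddGroup.mk_surjective).exists, (QuotientAddGroup.mk_surjective).exists]
      exact h

lemma nsmul_mem_iff_of_gcd_eq {A : Type} [AddCommGroup A] (H : AddSubgroup A) {a : A}
    {ρ k ℓ : ℕ} (ha : ρ • a ∈ H) (h : Nat.gcd ρ k = Nat.gcd ρ ℓ) : k • a ∈ H ↔ ℓ • a ∈ H := by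
  have key : ∀ m : ℕ, m • a ∈ H ↔ Nat.gcd ρ m • a ∈ H := by
    intro m
    constructor
    · intro hm
      rw [← natCast_zsmul, Nat.gcd_eq_gcd_ab, add_smul, mul_comm, mul_comm (m : ℤ), mul_smul,
        mul_smul, natCast_zsmul, natCast_zsmul]
      exact H.add_mem (H.zsmul_mem ha _) (H.zsmul_mem hm _)
    · intro hm
      obtain ⟨r, hr⟩ := Nat.gcd_dvd_right ρ m
      rw [hr, mul_comm, mul_smul]
      exact H.nsmul_mem hm r
  rw [key k, key ℓ, h]

/-- `castVec` as an additive homomorphism. -/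
def castVecHom (d : ℕ) : (Fin d → ℤ) →+ (Fin d → ℝ) where
  toFun := castVec
  map_zero' := by ext; simp [castVec]
  map_add' x y := by ext; simp [castVec]

lemma exists_bound_listZonotope {d : ℕ} (t : ℝ) (x : Fin d → ℝ) (l : List (Fin d → ℤ)) :
    ∃ B : ℝ, ∀ v ∈ listZonotope (castVecHom d) t x l, ‖v‖ ≤ B := by
  induction l with
  | nil => exact ⟨‖x‖, by simp [listZonotope]⟩
  | cons u l ih =>
    obtain ⟨B, hB⟩ := ih
    refine ⟨B + t * ‖castVecHom d u‖, ?_⟩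
    rintro v ⟨s, hs, hv⟩
    calc ‖v‖ = ‖(v - s • castVecHom d u) + s • castVecHom d u‖ := by simp
      _ ≤ ‖v - s • castVecHom d u‖ + ‖s • castVecHom d u‖ := norm_add_le _ _
      _ ≤ B + t * ‖castVecHom d u‖ := by
        rw [norm_smul, Real.norm_of_nonneg hs.1]
        gcongr
        · exact hB _ hv
        · exact hs.2

lemma finiteOnZonotopes_castVecHom (d : ℕ) : FiniteOnZonotopes (castVecHom d) := by
  intro t x l
  obtain ⟨B, hB⟩ := exists_bound_listZonotope t x l
  refine (Set.finite_Icc (fun _ : Fin d => -⌈B⌉) (fun _ => ⌈B⌉)).subset ?_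
  intro z hz
  have hi : ∀ i, |z i| ≤ ⌈B⌉ := by
    intro i
    have h : ‖castVecHom d z i‖ ≤ ⌈B⌉ :=
      ((norm_le_pi_norm (castVecHom d z) i).trans (hB _ hz)).trans (Int.le_ceil B)
    rw [Real.norm_eq_abs] at h
    change |(z i : ℝ)| ≤ ⌈B⌉ at h
    exact_mod_cast h
  exact ⟨fun i => (abs_le.1 (hi i)).1, fun i => (abs_le.1 (hi i)).2⟩

lemma mem_listZonotope_iff {Λ V : Type} [AddCommGroup Λ] [AddCommGroup V] [Module ℝ V]
    (φ : Λ →+ V) {t : ℝ} (ht : 0 < t) (x : V) {l : List Λ} (hl : l.Nodup) (v : V) :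
    v ∈ listZonotope φ t x l ↔ ∃ lam : Λ → ℝ, (∀ u, lam u ∈ Set.Icc (0 : ℝ) 1) ∧
      v = x + t • (l.map fun u => lam u • φ u).sum := by
  classical
  induction l generalizing v with
  | nil =>
    constructor
    · rintro rfl
      exact ⟨0, by simp, by simp⟩
    · rintro ⟨lam, -, rfl⟩
      simp [listZonotope]
  | cons u l ih =>
    obtain ⟨hu, hl⟩ := List.nodup_cons.1 hl
    constructor
    · rintro ⟨s, hs, hv⟩
      obtain ⟨lam, hlam, h⟩ := (ih hl _).1 hv
      refine ⟨Function.update lam u (s / t), fun w => ?_, ?_⟩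
      · rcases eq_or_ne w u with rfl | hw
        · simpa using ⟨div_nonneg hs.1 ht.le, (div_le_one ht).2 hs.2⟩
        · simpa [hw] using hlam w
      · have hmap : (l.map fun w => Function.update lam u (s / t) w • φ w) =
            l.map fun w => lam w • φ w := by
          refine List.map_congr_left fun w hw => ?_
          rw [Function.update_of_ne (ne_of_mem_of_not_mem hw hu)]
        rw [List.map_cons, List.sum_cons, hmap, Function.update_self, smul_add, smul_smul,
          mul_div_cancel₀ _ ht.ne', ← sub_add_cancel v (s • φ u), h]
        abel
    · rintro ⟨lam, hlam, rfl⟩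
      refine ⟨t * lam u, ⟨mul_nonneg ht.le (hlam u).1, mul_le_of_le_one_right ht.le (hlam u).2⟩,
        (ih hl _).2 ⟨lam, hlam, ?_⟩⟩
      rw [List.map_cons, List.sum_cons]
      module

lemma smul_vadd_zonotopeF {d : ℕ} (U : Finset (Fin d → ℤ)) (x : Fin d → ℝ) {t : ℝ}
    (ht : 0 < t) :
    t • (x +ᵥ zonotopeF U) = listZonotope (castVecHom d) t (t • x) U.toList := by
  ext v
  rw [mem_listZonotope_iff _ ht _ U.nodup_toList]
  simp only [Finset.sum_map_toList]
  constructor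
  · rintro ⟨_, ⟨_, ⟨lam, hlam, rfl⟩, rfl⟩, rfl⟩
    exact ⟨lam, hlam, smul_add _ _ _⟩
  · rintro ⟨lam, hlam, rfl⟩
    exact ⟨_, ⟨_, ⟨lam, hlam, rfl⟩, rfl⟩, smul_add _ _ _⟩

lemma ehr_zonotopeF {d : ℕ} (U : Finset (Fin d → ℤ)) (c : Fin d → ℚ) {t : ℕ} (ht : 0 < t) :
    ehr (zonotopeF U) c t =
      ((castVecHom d ⁻¹' listZonotope (castVecHom d) t (t • ratVec c) U.toList).ncard : ℚ) := by
  rw [ehr, latCount, smul_vadd_zonotopeF U (ratVec c) (Nat.cast_pos.2 ht), Nat.cast_smul_eq_nsmul]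
  rfl

lemma denv_pos {d : ℕ} (c : Fin d → ℚ) : 0 < denv c := by
  refine Nat.pos_of_ne_zero fun h => ?_
  obtain ⟨i, -, hi⟩ := Finset.lcm_eq_zero_iff.1 h
  exact (c i).den_nz hi

lemma denv_nsmul_ratVec {d : ℕ} (c : Fin d → ℚ) :
    ∃ z, denv c • ratVec c = castVecHom d z := by
  choose m hm using fun i => (Finset.dvd_lcm (Finset.mem_univ i) : (c i).den ∣ denv c)
  refine ⟨fun i => m i * (c i).num, funext fun i => ?_⟩
  have h : (denv c : ℚ) * c i = m i * (c i).num := by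
    rw [denv, hm i, Nat.cast_mul, mul_comm ((c i).den : ℚ), mul_assoc, Rat.den_mul_eq_num]
  have h' : (denv c : ℝ) * (c i : ℝ) = m i * (c i).num := by exact_mod_cast h
  simpa [castVecHom, castVec, ratVec] using h'

theorem exists_sub_castVecHom_mem_iff {d : ℕ} (c : Fin d → ℚ) {k ℓ : ℕ}
    (h : Nat.gcd (denv c) k = Nat.gcd (denv c) ℓ) (S : Submodule ℝ (Fin d → ℝ)) :
    (∃ z, k • ratVec c - castVecHom d z ∈ S) ↔ ∃ z, ℓ • ratVec c - castVecHom d z ∈ S := by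
  have key : ∀ v : Fin d → ℝ,
      (∃ z, v - castVecHom d z ∈ S) ↔ v ∈ S.toAddSubgroup ⊔ (castVecHom d).range := by
    intro v
    rw [AddSubgroup.mem_sup]
    constructor
    · rintro ⟨z, hz⟩
      exact ⟨_, hz, _, ⟨z, rfl⟩, sub_add_cancel _ _⟩
    · rintro ⟨s, hs, _, ⟨z, rfl⟩, rfl⟩
      exact ⟨z, by simpa using hs⟩
  rw [key, key]
  refine nsmul_mem_iff_of_gcd_eq _ ?_ h
  obtain ⟨z, hz⟩ := denv_nsmul_ratVec c
  exact (key _).1 ⟨z, by simp [hz]⟩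

lemma Polynomial.eq_of_eval_modEq {ρ : ℕ} (hρ : 0 < ρ) (k : ℕ) {p q : Polynomial ℚ}
    (h : ∀ t : ℕ, 0 < t → t % ρ = k % ρ → p.eval (t : ℚ) = q.eval (t : ℚ)) : p = q := by
  refine Polynomial.eq_of_infinite_eval_eq p q ?_
  have hinj : Function.Injective fun m : ℕ => ((k + (m + 1) * ρ : ℕ) : ℚ) := by
    intro m n hmn
    have h1 : k + (m + 1) * ρ = k + (n + 1) * ρ := Nat.cast_injective hmn
    have h2 := Nat.eq_of_mul_eq_mul_right hρ (Nat.add_left_cancel h1)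
    omega
  refine (Set.infinite_range_of_injective hinj).mono ?_
  rintro _ ⟨m, rfl⟩
  exact h _ (by positivity) (by simp)

/-- The Ehrhart quasi-polynomial of an almost integral zonotope
`c + Z(U)` satisfies the GCD-property with respect to the period `den(c)`. -/
theorem gcd_property_of_almost_integral_zonotope
    (d : ℕ) (U : Finset (Fin d → ℤ)) (c : Fin d → ℚ) :
    GCDProperty (ehr (zonotopeF U) c) (denv c) := by
  intro f hf k ℓ hkℓ
  have hφ := finiteOnZonotopes_castVecHom d
  obtain ⟨p, hp⟩ :=
    exists_polynomial_ncard_preimage_listZonotope _ hφ U.toList rfl (k • ratVec c)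
  have key : ∀ m : ℕ, Nat.gcd (denv c) k = Nat.gcd (denv c) m → f (m % denv c) = p := by
    intro m hm
    refine Polynomial.eq_of_eval_modEq (denv_pos c) m fun t ht htm => ?_
    have hgcd : Nat.gcd (denv c) t = Nat.gcd (denv c) k := by
      rw [hm, Nat.gcd_comm, Nat.gcd_comm _ m]
      exact Nat.ModEq.gcd_eq htm
    rw [← htm, ← hf t ht, ehr_zonotopeF U c ht, ← hp,
      ncard_preimage_listZonotope_congr _ hφ U.toList rfl _ _
        (exists_sub_castVecHom_mem_iff c hgcd)]
  rw [key k rfl, key ℓ hkℓ]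
end
end

section
/- Let P ⊂ ℝ^d be a lattice polytope of dimension d and let c ∈ ℝ^d. Then there exists a polynomial f ∈ ℚ[x] of degree d with leading coefficient equal to the d-dimensional Euclidean volume vol_d(P) such that #((c + tP) ∩ ℤ^d) = f(t) for every positive integer t. -/
open Pointwise MeasureTheory
open scoped RealInnerProductSpace

noncomputable section

open Polynomial Filter Topology

section LexMax

variable {n : ℕ} {E : Type*} [AddCommGroup E] [Module ℝ E]

/-- A nonnegative vector that is lexicographically maximal among the nonnegative vectors with the
same image under `φ`. -/
def IsLexMax (φ : (Fin n → ℝ) →ₗ[ℝ] E) (a : Fin n → ℝ) : Prop :=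
  0 ≤ a ∧ ∀ b, 0 ≤ b → φ b = φ a → toLex b ≤ toLex a

lemma IsLexMax.eq_of_map_eq {φ : (Fin n → ℝ) →ₗ[ℝ] E} {a b : Fin n → ℝ}
    (ha : IsLexMax φ a) (hb : IsLexMax φ b) (h : φ a = φ b) : a = b :=
  toLex.injective (le_antisymm (hb.2 a ha.1 h) (ha.2 b hb.1 h.symm))

/-- Lexicographic maximality is inherited by vectors of smaller support. -/
lemma IsLexMax.of_support_subset {φ : (Fin n → ℝ) →ₗ[ℝ] E} {a a' : Fin n → ℝ}
    (ha : IsLexMax φ a) (ha' : 0 ≤ a') (hsupp : ∀ i, a i = 0 → a' i = 0) : IsLexMax φ a' := by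
  refine ⟨ha', fun b hb hφ => ?_⟩
  by_contra! hlt
  obtain ⟨M, hM0, hM⟩ : ∃ M : ℝ, 0 < M ∧ ∀ i, a' i ≤ M * a i := by
    have hnn : ∀ j, 0 ≤ a' j / a j := fun j => div_nonneg (ha' j) (ha.1 j)
    refine ⟨∑ j, a' j / a j + 1, by have := Finset.sum_nonneg fun j (_ : j ∈ Finset.univ) => hnn j
                                    linarith, fun i => ?_⟩
    rcases eq_or_ne (a i) 0 with h0 | h0
    · simp [h0, hsupp i h0]
    · have h1 := Finset.single_le_sum (fun j _ => hnn j) (Finset.mem_univ i)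
      have h2 : a' i = a' i / a i * a i := by field_simp
      have h3 := ha.1 i
      simp only [Pi.zero_apply] at h3
      nlinarith
  have hle := ha.2 (a + M⁻¹ • (b - a')) (fun i => ?_) (by simp [hφ])
  · refine absurd hle (not_le.2 ?_)
    obtain ⟨i, hi, hlt⟩ := hlt
    refine ⟨i, fun j hj => ?_, ?_⟩
    · have := hi j hj
      simp only [Pi.toLex_apply] at this
      simp [this]
    · simp only [Pi.toLex_apply] at hlt
      have : 0 < M⁻¹ * (b i - a' i) := mul_pos (inv_pos.2 hM0) (sub_pos.2 hlt)
      simpa using this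
  · have h1 : M⁻¹ * a' i ≤ a i := by
      rw [inv_mul_le_iff₀ hM0]; exact hM i
    have h2 : 0 ≤ M⁻¹ * b i := mul_nonneg (inv_nonneg.2 hM0.le) (hb i)
    simp only [Pi.zero_apply, Pi.add_apply, Pi.smul_apply, Pi.sub_apply, smul_eq_mul, mul_sub]
    linarith

lemma IsCompact.exists_forall_toLex_le {K : Set (Fin n → ℝ)} (hK : IsCompact K)
    (hne : K.Nonempty) : ∃ a ∈ K, ∀ b ∈ K, toLex b ≤ toLex a := by
  have key : ∀ m ≤ n, ∃ a ∈ K, ∀ b ∈ K, (∀ j : Fin n, j.1 < m → b j = a j) ∨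
      ∃ i : Fin n, (∀ j < i, b j = a j) ∧ i.1 < m ∧ b i < a i := by
    intro m
    induction m with
    | zero =>
      obtain ⟨a, ha⟩ := hne
      exact fun _ => ⟨a, ha, fun b _ => Or.inl (by simp)⟩
    | succ m ih =>
      intro hm
      obtain ⟨a, ha, hmax⟩ := ih (by omega)
      have hcl : IsClosed {b : Fin n → ℝ | ∀ j : Fin n, j.1 < m → b j = a j} := by
        simp only [Set.ofPred_forall]
        exact isClosed_iInter fun j => isClosed_iInter fun _ =>
          isClosed_eq (continuous_apply j) continuous_const
      obtain ⟨a', ⟨ha'K, ha'⟩, hmax'⟩ := (hK.inter_right hcl).exists_isMaxOn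
        ⟨a, ha, fun _ _ => rfl⟩ (continuous_apply (⟨m, hm⟩ : Fin n)).continuousOn
      refine ⟨a', ha'K, fun b hb => ?_⟩
      rcases hmax b hb with h | ⟨i, hi, him, hlt⟩
      · have hle : b ⟨m, hm⟩ ≤ a' ⟨m, hm⟩ := hmax' (show b ∈ K ∩ _ from ⟨hb, h⟩)
        rcases hle.lt_or_eq with hlt | heq
        · refine Or.inr ⟨⟨m, hm⟩, fun j hj => ?_, Nat.lt_succ_self m, hlt⟩
          have hj' : j.1 < m := hj
          rw [h j hj', ha' j hj']
        · refine Or.inl fun j hj => ?_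
          rcases Nat.lt_succ_iff_lt_or_eq.1 hj with hj | hj
          · rw [h j hj, ha' j hj]
          · obtain rfl : j = ⟨m, hm⟩ := Fin.ext hj
            exact heq
      · refine Or.inr ⟨i, fun j hj => ?_, by omega, ?_⟩
        · rw [hi j hj, ha' j (lt_trans hj him)]
        · rw [ha' i him]; exact hlt
  obtain ⟨a, ha, hmax⟩ := key n le_rfl
  refine ⟨a, ha, fun b hb => ?_⟩
  rcases hmax b hb with h | ⟨i, hi, -, hlt⟩
  · exact (congrArg toLex (funext fun j => h j j.2)).le
  · exact le_of_lt ⟨i, hi, hlt⟩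

end LexMax

/-- The polynomial agreeing with `t ↦ #{m : ℕ^s | ∑ m = t - h}` at positive `t`, for `h ≤ s`. -/
noncomputable def compositionPoly (s h : ℕ) : ℚ[X] :=
  if s = 0 then 0 else preHilbertPoly ℚ (s - 1) h

lemma eval_compositionPoly {ι : Type*} [DecidableEq ι] (S : Finset ι) {h t : ℕ}
    (hh : h ≤ S.card) (ht : 0 < t) :
    (((if h ≤ t then S.finsuppAntidiag (t - h) else ∅ : Finset (ι →₀ ℕ)).card : ℕ) : ℚ) =
      (compositionPoly S.card h).eval (t : ℚ) := by
  rcases Nat.eq_zero_or_pos S.card with hs | hs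
  · obtain rfl : h = 0 := by omega
    rw [Finset.card_eq_zero] at hs
    subst hs
    simp [compositionPoly, Finset.finsuppAntidiag_empty_of_ne_zero ht.ne']
  · rw [compositionPoly, if_neg hs.ne']
    split_ifs with hht
    · rw [preHilbertPoly_eq_choose_sub_add ℚ _ hht, Finset.card_finsuppAntidiag_nat_eq_choose,
        show S.card + (t - h) - 1 = (S.card - 1) + (t - h) by omega,
        ← Nat.choose_symm_add, add_comm]
    · have := ascPochhammer_eval_neg_coe_nat_of_lt (R := ℚ)
        (show h - t - 1 < S.card - 1 by omega)
      rw [show (-((h - t - 1 : ℕ) : ℚ)) = t - h + 1 by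
        rw [Nat.sub_sub, Nat.cast_sub (by omega)]; push_cast; ring] at this
      simp [preHilbertPoly, this]

section Counting

variable {d n : ℕ}

lemma castVec_injective : Function.Injective (castVec : (Fin d → ℤ) → Fin d → ℝ) :=
  fun x y h => funext fun i => by simpa [castVec] using congrFun h i

lemma finite_castVec_mem {S : Set (Fin d → ℝ)} (hS : Bornology.IsBounded S) :
    {x : Fin d → ℤ | castVec x ∈ S}.Finite := by
  obtain ⟨B, hB⟩ := hS.exists_norm_le
  refine (Set.finite_Icc (fun _ : Fin d => -⌈B⌉) (fun _ => ⌈B⌉)).subset fun x hx => ?_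
  have h : ∀ i, |(x i : ℝ)| ≤ ⌈B⌉ := fun i =>
    ((norm_le_pi_norm (castVec x) i).trans (hB _ hx)).trans (Int.le_ceil B)
  exact ⟨fun i => by exact_mod_cast (abs_le.1 (h i)).1, fun i => by exact_mod_cast (abs_le.1 (h i)).2⟩

/-- The linear map sending coefficients `a` to `∑ aᵢ (vᵢ, 1)`. -/
def coneMap (v : Fin n → Fin d → ℤ) : (Fin n → ℝ) →ₗ[ℝ] (Fin d → ℝ) × ℝ :=
  (Fintype.linearCombination ℝ fun i => castVec (v i)).prod (∑ i, LinearMap.proj i)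

lemma coneMap_apply (v : Fin n → Fin d → ℤ) (a : Fin n → ℝ) :
    coneMap v a = (∑ i, a i • castVec (v i), ∑ i, a i) := by
  simp [coneMap, Fintype.linearCombination_apply]

lemma coneMap_natCast (v : Fin n → Fin d → ℤ) (m : Fin n →₀ ℕ) :
    (coneMap v fun i => (m i : ℝ)) = (castVec (∑ i, m i • v i), ((∑ i, m i : ℕ) : ℝ)) := by
  rw [coneMap_apply]
  ext j <;> simp [castVec]

lemma exists_isLexMax_coneMap (v : Fin n → Fin d → ℤ) {a : Fin n → ℝ} (ha : 0 ≤ a) :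
    ∃ b, IsLexMax (coneMap v) b ∧ coneMap v b = coneMap v a := by
  have hK : IsCompact (Set.Icc 0 (fun _ => ∑ i, a i) ∩ {b | coneMap v b = coneMap v a}) :=
    isCompact_Icc.inter_right
      (isClosed_eq (LinearMap.continuous_of_finiteDimensional _) continuous_const)
  have hmem : ∀ b, 0 ≤ b → coneMap v b = coneMap v a →
      b ∈ Set.Icc 0 (fun _ => ∑ i, a i) ∩ {b | coneMap v b = coneMap v a} := by
    refine fun b hb h => ⟨⟨hb, fun i => ?_⟩, h⟩
    have : ∑ i, b i = ∑ i, a i := by simpa [coneMap_apply] using congrArg Prod.snd h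
    rw [← this]
    exact Finset.single_le_sum (fun j _ => hb j) (Finset.mem_univ i)
  obtain ⟨b, ⟨hb, hbeq⟩, hmax⟩ := hK.exists_forall_toLex_le ⟨a, hmem a ha rfl⟩
  exact ⟨b, ⟨hb.1, fun b' hb' h => hmax b' (hmem b' hb' (h.trans hbeq))⟩, hbeq⟩

lemma mem_vadd_smul_convexHull_iff (v : Fin n → Fin d → ℤ) (c x : Fin d → ℝ) {t : ℝ}
    (ht : 0 < t) :
    x ∈ c +ᵥ t • convexHull ℝ (Set.range fun i => castVec (v i)) ↔
      ∃ a, 0 ≤ a ∧ coneMap v a = (x - c, t) := by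
  have hP : convexHull ℝ (Set.range fun i => castVec (v i)) =
      Fintype.linearCombination ℝ (fun i => castVec (v i)) '' stdSimplex ℝ (Fin n) := by
    rw [← convexHull_rangle_single_eq_stdSimplex, LinearMap.image_convexHull, ← Set.range_comp]
    congr 2
    ext i : 1
    simp
  rw [hP, Set.mem_vadd_set_iff_neg_vadd_mem, Set.mem_smul_set_iff_inv_smul_mem₀ ht.ne']
  simp only [Set.mem_image, Fintype.linearCombination_apply, coneMap_apply, Prod.mk.injEq,
    vadd_eq_add]
  constructor
  · rintro ⟨w, ⟨hw0, hw1⟩, hw⟩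
    refine ⟨t • w, smul_nonneg ht.le hw0, ?_, by simp [← Finset.mul_sum, hw1]⟩
    rw [eq_inv_smul_iff₀ ht.ne', Finset.smul_sum] at hw
    simp only [Pi.smul_apply, smul_assoc, hw]
    abel
  · rintro ⟨a, ha, hax, hat⟩
    refine ⟨t⁻¹ • a, ⟨fun i => ?_, by simp [← Finset.mul_sum, hat, ht.ne']⟩, ?_⟩
    · exact mul_nonneg (inv_nonneg.2 ht.le) (ha i)
    · simp only [Pi.smul_apply, smul_assoc, ← Finset.smul_sum, hax]
      congr 1
      abel

/-- The lexicographically maximal coefficient vectors in the unit cube representing a lattice point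
of the translated homogenized cone. -/
def fundamentalCoeffs (v : Fin n → Fin d → ℤ) (c : Fin d → ℝ) : Set (Fin n → ℝ) :=
  {r | IsLexMax (coneMap v) r ∧ (∀ i, r i ≤ 1) ∧
    ∃ (y : Fin d → ℤ) (h : ℕ), coneMap v r = (castVec y - c, (h : ℝ))}

lemma finite_fundamentalCoeffs (v : Fin n → Fin d → ℤ) (c : Fin d → ℝ) :
    (fundamentalCoeffs v c).Finite := by
  have hbdd : Bornology.IsBounded (coneMap v '' Set.Icc 0 1) :=
    (isCompact_Icc.image (LinearMap.continuous_of_finiteDimensional _)).isBounded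
  have hfst := finite_castVec_mem
    (((hbdd.image_fst.vadd c)))
  refine Set.Finite.of_finite_image (f := coneMap v) (((hfst.image fun y => castVec y - c).prod
    ((Set.finite_Iic n).image ((↑) : ℕ → ℝ))).subset ?_) fun r hr s hs h =>
      hr.1.eq_of_map_eq hs.1 h
  rintro _ ⟨r, ⟨hr, hr1, y, h, hy⟩, rfl⟩
  rw [hy]
  refine ⟨⟨y, ⟨castVec y - c, ⟨coneMap v r, ⟨r, ⟨hr.1, hr1⟩, rfl⟩, by rw [hy]⟩, by simp⟩, rfl⟩,
    ⟨h, ?_, rfl⟩⟩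
  have hsum : ∑ i, r i = h := by simpa [coneMap_apply] using congrArg Prod.snd hy
  have : ∑ i, r i ≤ ∑ _i : Fin n, (1 : ℝ) := Finset.sum_le_sum fun i _ => hr1 i
  rw [hsum] at this
  simpa using this


lemma snd_coneMap_le_card_of_mem_fundamentalCoeffs {v : Fin n → Fin d → ℤ} {c : Fin d → ℝ}
    {r : Fin n → ℝ} (hr : r ∈ fundamentalCoeffs v c) :
    (coneMap v r).2 ≤ (Finset.univ.filter fun i => r i ≠ 0).card := by
  rw [coneMap_apply, Finset.card_filter]
  push_cast
  refine Finset.sum_le_sum fun i _ => ?_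
  split_ifs with h
  · exact hr.2.1 i
  · exact (not_not.1 h).le

/-- Pairs of a fundamental coefficient vector and a natural vector supported on its support, of
total height `t`. -/
def coeffPairs (v : Fin n → Fin d → ℤ) (c : Fin d → ℝ) (t : ℕ) :
    Finset (Σ _ : Fin n → ℝ, Fin n →₀ ℕ) :=
  (finite_fundamentalCoeffs v c).toFinset.sigma fun r =>
    if ⌊(coneMap v r).2⌋₊ ≤ t then
      (Finset.univ.filter fun i => r i ≠ 0).finsuppAntidiag (t - ⌊(coneMap v r).2⌋₊) else ∅

lemma mem_coeffPairs {v : Fin n → Fin d → ℤ} {c : Fin d → ℝ} {t : ℕ}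
    {p : Σ _ : Fin n → ℝ, Fin n →₀ ℕ} :
    p ∈ coeffPairs v c t ↔ p.1 ∈ fundamentalCoeffs v c ∧
      (coneMap v p.1).2 + ((∑ i, p.2 i : ℕ) : ℝ) = t ∧ ∀ i, p.1 i = 0 → p.2 i = 0 := by
  rw [coeffPairs, Finset.mem_sigma, Set.Finite.mem_toFinset]
  refine and_congr_right fun hr => ?_
  obtain ⟨y, h, hy⟩ := hr.2.2
  have hsum : (p.2.support ⊆ Finset.univ.filter fun i => p.1 i ≠ 0) →
      (Finset.univ.filter fun i => p.1 i ≠ 0).sum p.2 = ∑ i, p.2 i := fun hs =>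
    Finset.sum_subset (Finset.subset_univ _) fun i _ hi => by
      by_contra h0
      exact hi (hs (Finsupp.mem_support_iff.2 h0))
  have hsub : (p.2.support ⊆ Finset.univ.filter fun i => p.1 i ≠ 0) ↔
      ∀ i, p.1 i = 0 → p.2 i = 0 := by
    simp only [Finset.subset_iff, Finsupp.mem_support_iff, Finset.mem_filter, Finset.mem_univ,
      true_and]
    exact forall_congr' fun i => not_imp_not
  rw [hy, Nat.floor_natCast, ← hsub]
  dsimp only
  norm_cast
  split_ifs with ht
  · rw [Finset.mem_finsuppAntidiag]
    constructor
    · rintro ⟨h1, h2⟩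
      rw [hsum h2] at h1
      exact ⟨by omega, h2⟩
    · rintro ⟨h1, h2⟩
      rw [hsum h2]
      exact ⟨by omega, h2⟩
  · simp only [Finset.notMem_empty, false_iff, not_and]
    intro h1
    omega

/-- `#(coeffPairs v c t)` is a polynomial in `t > 0`. -/
lemma exists_poly_card_coeffPairs (v : Fin n → Fin d → ℤ) (c : Fin d → ℝ) :
    ∃ f : ℚ[X], ∀ t : ℕ, 0 < t → ((coeffPairs v c t).card : ℚ) = f.eval (t : ℚ) := by
  refine ⟨∑ r ∈ (finite_fundamentalCoeffs v c).toFinset,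
    compositionPoly (Finset.univ.filter fun i => r i ≠ 0).card ⌊(coneMap v r).2⌋₊,
    fun t ht => ?_⟩
  rw [coeffPairs, Finset.card_sigma, Nat.cast_sum, eval_finsetSum]
  refine Finset.sum_congr rfl fun r hr => eval_compositionPoly _ ?_ ht
  exact Nat.floor_le_of_le
    (snd_coneMap_le_card_of_mem_fundamentalCoeffs ((finite_fundamentalCoeffs v c).mem_toFinset.1 hr))

/-- The coefficient vector of a pair. -/
def pairCoeff (p : Σ _ : Fin n → ℝ, Fin n →₀ ℕ) : Fin n → ℝ := p.1 + fun i => (p.2 i : ℝ)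

lemma coneMap_pairCoeff (v : Fin n → Fin d → ℤ) (p : Σ _ : Fin n → ℝ, Fin n →₀ ℕ) :
    coneMap v (pairCoeff p) =
      coneMap v p.1 + (castVec (∑ i, p.2 i • v i), ((∑ i, p.2 i : ℕ) : ℝ)) := by
  rw [pairCoeff, map_add, coneMap_natCast]

lemma isLexMax_pairCoeff {v : Fin n → Fin d → ℤ} {c : Fin d → ℝ} {t : ℕ}
    {p : Σ _ : Fin n → ℝ, Fin n →₀ ℕ} (hp : p ∈ coeffPairs v c t) :
    IsLexMax (coneMap v) (pairCoeff p) := by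
  obtain ⟨hr, -, hs⟩ := mem_coeffPairs.1 hp
  refine hr.1.of_support_subset (fun i => add_nonneg (hr.1.1 i) (Nat.cast_nonneg _)) fun i hi => ?_
  simp [pairCoeff, hi, hs i hi]

lemma injOn_pairCoeff (v : Fin n → Fin d → ℤ) (c : Fin d → ℝ) (t : ℕ) :
    Set.InjOn pairCoeff (coeffPairs v c t : Set (Σ _ : Fin n → ℝ, Fin n →₀ ℕ)) := by
  rintro ⟨r, m⟩ hp ⟨r', m'⟩ hp' h
  obtain ⟨hr, -, hs⟩ := mem_coeffPairs.1 hp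
  obtain ⟨hr', -, hs'⟩ := mem_coeffPairs.1 hp'
  have hi : ∀ i, r i + m i = r' i + m' i := fun i => congrFun h i
  have hm : m = m' := by
    ext i
    have h0 : 0 ≤ r i := hr.1.1 i
    have h0' : 0 ≤ r' i := hr'.1.1 i
    have h1 := hr.2.1 i
    have h1' := hr'.2.1 i
    have hii := hi i
    dsimp only at hs hs' h1 h1'
    have hmn : (0 : ℝ) ≤ m i := Nat.cast_nonneg _
    have hmn' : (0 : ℝ) ≤ m' i := Nat.cast_nonneg _
    rcases h0.eq_or_lt with h0 | h0
    · rw [hs i h0.symm, hs' i (by rw [← h0, hs i h0.symm] at hii; push_cast at hii; linarith)]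
    rcases h0'.eq_or_lt with h0' | h0'
    · rw [hs i (by rw [← h0', hs' i h0'.symm] at hii; push_cast at hii; linarith),
        hs' i h0'.symm]
    · have e1 : (m i : ℝ) < m' i + 1 := by linarith
      have e2 : (m' i : ℝ) < m i + 1 := by linarith
      norm_cast at e1 e2
      omega
  subst hm
  obtain rfl : r = r' := funext fun i => by simpa using hi i
  rfl

lemma castVec_add (x y : Fin d → ℤ) : castVec (x + y) = castVec x + castVec y := by
  ext i; simp [castVec]

lemma castVec_sub (x y : Fin d → ℤ) : castVec (x - y) = castVec x - castVec y := by
  ext i; simp [castVec]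

lemma image_coneMap_pairCoeff (v : Fin n → Fin d → ℤ) (c : Fin d → ℝ) {t : ℕ} (ht : 0 < t) :
    (fun p => coneMap v (pairCoeff p)) '' (coeffPairs v c t : Set (Σ _ : Fin n → ℝ, Fin n →₀ ℕ)) =
      (fun x => (castVec x - c, (t : ℝ))) ''
        {x | castVec x ∈ c +ᵥ (t : ℝ) • convexHull ℝ (Set.range fun i => castVec (v i))} := by
  apply Set.Subset.antisymm
  · rintro _ ⟨p, hp, rfl⟩
    obtain ⟨⟨-, -, y, h, hy⟩, hsum, -⟩ := mem_coeffPairs.1 hp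
    have key : coneMap v (pairCoeff p) = (castVec (y + ∑ i, p.2 i • v i) - c, (t : ℝ)) := by
      rw [coneMap_pairCoeff, ← hsum, hy, castVec_add, Prod.mk_add_mk, sub_add_eq_add_sub]
    exact ⟨_, (mem_vadd_smul_convexHull_iff v c _ (by exact_mod_cast ht)).2
      ⟨_, (isLexMax_pairCoeff hp).1, key⟩, key.symm⟩
  · rintro _ ⟨x, hx, rfl⟩
    obtain ⟨a', ha', hax'⟩ := (mem_vadd_smul_convexHull_iff v c _ (by exact_mod_cast ht)).1 hx
    obtain ⟨a, ha, hax⟩ := exists_isLexMax_coneMap v ha'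
    rw [hax'] at hax
    have ha0 : ∀ i, 0 ≤ a i := ha.1
    let m : Fin n →₀ ℕ := Finsupp.equivFunOnFinite.symm fun i => ⌈a i⌉₊ - 1
    have hm0 : ∀ i, a i = 0 → m i = 0 := fun i hi => by simp [m, hi]
    have hm1 : ∀ i, a i ≠ 0 → (m i : ℝ) + 1 = ⌈a i⌉₊ := fun i hi => by
      have : 0 < ⌈a i⌉₊ := Nat.ceil_pos.2 (lt_of_le_of_ne (ha0 i) hi.symm)
      simp only [m, Finsupp.equivFunOnFinite_symm_apply_apply]
      exact_mod_cast Nat.sub_add_cancel this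
    let r : Fin n → ℝ := fun i => a i - m i
    have hr : ∀ i, 0 ≤ r i ∧ r i ≤ 1 ∧ (a i ≠ 0 → 0 < r i) := fun i => by
      rcases eq_or_ne (a i) 0 with hi | hi
      · simp [r, hi, hm0 i hi]
      · have h1 := Nat.le_ceil (a i)
        have h2 := Nat.ceil_lt_add_one (ha0 i)
        have h3 := hm1 i hi
        simp only [r]
        exact ⟨by linarith, by linarith, fun _ => by linarith⟩
    have hpair : pairCoeff ⟨r, m⟩ = a := by ext i; simp [pairCoeff, r]
    have hrm := coneMap_pairCoeff v ⟨r, m⟩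
    rw [hpair, hax] at hrm
    have hrm1 := congrArg Prod.fst hrm
    have hrm2 := congrArg Prod.snd hrm
    simp only [Prod.fst_add, Prod.snd_add] at hrm1 hrm2
    have hr2 : 0 ≤ (coneMap v r).2 := by
      simpa only [coneMap_apply] using Finset.sum_nonneg fun i (_ : i ∈ Finset.univ) => (hr i).1
    have hle : ∑ i, m i ≤ t := by
      have : ((∑ i, m i : ℕ) : ℝ) ≤ t := by linarith
      exact_mod_cast this
    refine ⟨⟨r, m⟩, mem_coeffPairs.2 ⟨⟨ha.of_support_subset (fun i => (hr i).1) fun i hi => ?_,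
      fun i => (hr i).2.1, x - ∑ i, m i • v i, t - ∑ i, m i, ?_⟩, hrm2.symm, fun i hi => ?_⟩, ?_⟩
    · simp [r, hi, hm0 i hi]
    · refine Prod.ext ?_ ?_
      · rw [castVec_sub]
        simp only
        rw [sub_right_comm, hrm1, add_sub_cancel_right]
      · rw [Nat.cast_sub hle]
        simp only
        linarith
    · by_contra h0
      exact ((hr i).2.2 fun h => h0 (hm0 i h)).ne' hi
    · simp only [hpair, hax]

lemma latCount_eq_card_coeffPairs (v : Fin n → Fin d → ℤ) (c : Fin d → ℝ) {t : ℕ} (ht : 0 < t) :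
    latCount (c +ᵥ (t : ℝ) • convexHull ℝ (Set.range fun i => castVec (v i))) =
      (coeffPairs v c t).card := by
  have hinj : Function.Injective fun x : Fin d → ℤ => (castVec x - c, (t : ℝ)) := fun x y h =>
    castVec_injective (sub_left_injective (congrArg Prod.fst h))
  rw [latCount, ← Set.ncard_image_of_injective _ hinj, ← image_coneMap_pairCoeff v c ht,
    Set.InjOn.ncard_image fun p hp q hq h => injOn_pairCoeff v c t hp hq
      ((isLexMax_pairCoeff hp).eq_of_map_eq (isLexMax_pairCoeff hq) h), Set.ncard_coe_finset]

end Counting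

lemma IsLatticePolytope.exists_poly_latCount {d : ℕ} {P : Set (Fin d → ℝ)}
    (hP : IsLatticePolytope P) (c : Fin d → ℝ) :
    ∃ f : ℚ[X], ∀ t : ℕ, 0 < t → (latCount (c +ᵥ (t : ℝ) • P) : ℚ) = f.eval (t : ℚ) := by
  obtain ⟨V, -, rfl⟩ := hP
  let v : Fin V.card → Fin d → ℤ := fun i => V.equivFin.symm i
  have hv : castVec '' (V : Set (Fin d → ℤ)) = Set.range fun i => castVec (v i) := by
    change _ = Set.range (castVec ∘ Subtype.val ∘ V.equivFin.symm)
    rw [Set.range_comp, Set.range_comp, V.equivFin.symm.range_eq_univ, Set.image_univ]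
    simp
  obtain ⟨f, hf⟩ := exists_poly_card_coeffPairs v c
  exact ⟨f, fun t ht => by rw [hv, latCount_eq_card_coeffPairs v c ht, hf t ht]⟩

section Volume

variable {d : ℕ} {P : Set (Fin d → ℝ)}

lemma tendsto_latCount_div_pow (hP : Convex ℝ P) (hPc : IsCompact P) :
    Tendsto (fun t : ℕ => (latCount ((t : ℝ) • P) : ℝ) / t ^ d) atTop (𝓝 (volume P).toReal) := by
  have h := tendsto_card_div_pow_atTop_volume P hPc.isBounded hPc.measurableSet
    (hP.addHaar_frontier volume)
  rw [Fintype.card_fin] at h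
  refine h.congr' ?_
  filter_upwards [eventually_gt_atTop 0] with t ht
  have ht' : (t : ℝ) ≠ 0 := by positivity
  congr 2
  rw [latCount, Nat.card_coe_set_eq, ← Set.ncard_image_of_injective _ castVec_injective,
    ← Set.ncard_image_of_injective _ (smul_right_injective (Fin d → ℝ) ht')]
  congr 1
  ext x
  simp only [Set.mem_image, Set.mem_inter_iff, Set.mem_ofPred_eq]
  constructor
  · rintro ⟨y, ⟨hyP, hy⟩, rfl⟩
    rw [Set.mem_smul_set_iff_inv_smul_mem₀ (inv_ne_zero ht'), inv_inv] at hy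
    choose z hz using (Module.Basis.mem_span_iff_repr_mem ℤ (Pi.basisFun ℝ (Fin d)) _).1 hy
    have hz' : castVec z = (t : ℝ) • y := funext fun i => by simpa [castVec] using hz i
    exact ⟨z, hz' ▸ Set.smul_mem_smul_set hyP, hz'⟩
  · rintro ⟨z, ⟨y, hy, hyz⟩, rfl⟩
    refine ⟨y, ⟨hy, ?_⟩, hyz⟩
    rw [Set.mem_smul_set_iff_inv_smul_mem₀ (inv_ne_zero ht'), inv_inv]
    refine (Module.Basis.mem_span_iff_repr_mem ℤ (Pi.basisFun ℝ (Fin d)) _).2 fun i => ⟨z i, ?_⟩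
    simpa [castVec] using (congrFun hyz i).symm

/-- A polynomial which grows like `V * t ^ d` with `V > 0` has degree `d` and leading
coefficient `V`. -/
lemma natDegree_eq_of_tendsto_div_pow {f : ℝ[X]} {V : ℝ} (hV : 0 < V)
    (h : Tendsto (fun t : ℕ => f.eval (t : ℝ) / t ^ d) atTop (𝓝 V)) :
    f.natDegree = d ∧ f.leadingCoeff = V := by
  have hX : (X ^ d : ℝ[X]) ≠ 0 := pow_ne_zero _ X_ne_zero
  have hXd : (X ^ d : ℝ[X]).degree = d := degree_X_pow d
  have hev : (fun t : ℕ => f.eval (t : ℝ) / (X ^ d : ℝ[X]).eval (t : ℝ)) =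
      fun t : ℕ => f.eval (t : ℝ) / t ^ d := by simp
  rw [← hev] at h
  rcases lt_trichotomy f.degree (X ^ d : ℝ[X]).degree with hlt | heq | hgt
  · exact absurd (tendsto_nhds_unique h
      ((div_tendsto_atTop_zero_of_degree_lt f _ hlt).comp tendsto_natCast_atTop_atTop)) hV.ne'
  · have := tendsto_nhds_unique h
      ((div_tendsto_atTop_leadingCoeff_div_of_degree_eq f _ heq).comp tendsto_natCast_atTop_atTop)
    rw [leadingCoeff_X_pow, div_one] at this
    exact ⟨natDegree_eq_of_degree_eq_some (heq.trans hXd), this.symm⟩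
  · exact absurd h.abs (not_tendsto_nhds_of_tendsto_atTop
      ((abs_div_tendsto_atTop_atTop_of_degree_gt f _ hgt hX).comp tendsto_natCast_atTop_atTop) _)

lemma tendsto_eval_div_pow_natDegree {f : ℝ[X]} (hf : f ≠ 0) :
    Tendsto (fun t : ℕ => f.eval (t : ℝ) / t ^ f.natDegree) atTop (𝓝 f.leadingCoeff) := by
  have h := (div_tendsto_atTop_leadingCoeff_div_of_degree_eq f (X ^ f.natDegree)
    (by rw [degree_X_pow, degree_eq_natDegree hf])).comp (tendsto_natCast_atTop_atTop (R := ℝ))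
  simpa [Function.comp_def] using h

/-- Some dilate of a set with nonempty interior contains an integral translate of every point. -/
lemma exists_forall_exists_castVec_add_mem_smul (hP : (interior P).Nonempty) :
    ∃ k : ℕ, ∀ c : Fin d → ℝ, ∃ w : Fin d → ℤ, c + castVec w ∈ (k : ℝ) • P := by
  obtain ⟨p, hp⟩ := hP
  obtain ⟨ε, hε, hball⟩ := Metric.mem_nhds_iff.1 (mem_interior_iff_mem_nhds.1 hp)
  obtain ⟨k, hk⟩ := exists_nat_gt (1 / ε)
  have hk0 : (0 : ℝ) < k := (by positivity : 0 < 1 / ε).trans hk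
  refine ⟨k, fun c => ⟨fun i => ⌊k * p i - c i⌋, ?_⟩⟩
  rw [Set.mem_smul_set_iff_inv_smul_mem₀ hk0.ne']
  apply hball
  rw [mem_ball_iff_norm, ← mul_lt_mul_iff_right₀ hk0]
  refine lt_of_le_of_lt ?_ ((div_lt_iff₀ hε).1 hk)
  rw [← Real.norm_of_nonneg hk0.le, ← norm_smul, smul_sub, smul_smul,
    Real.norm_of_nonneg hk0.le, mul_inv_cancel₀ hk0.ne', one_smul,
    pi_norm_le_iff_of_nonneg zero_le_one]
  intro i
  have h1 := Int.floor_le (k * p i - c i)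
  have h2 := Int.lt_floor_add_one (k * p i - c i)
  simp only [Pi.sub_apply, Pi.add_apply, castVec, Pi.smul_apply, smul_eq_mul, Real.norm_eq_abs,
    abs_le]
  constructor <;> linarith

lemma latCount_mono {S T : Set (Fin d → ℝ)} (hT : Bornology.IsBounded T) (h : S ⊆ T) :
    latCount S ≤ latCount T :=
  Set.ncard_le_ncard (fun _ hx => h hx) (finite_castVec_mem hT)

lemma latCount_castVec_vadd (w : Fin d → ℤ) (S : Set (Fin d → ℝ)) :
    latCount (castVec w +ᵥ S) = latCount S := by
  rw [latCount, latCount, ← Set.ncard_image_of_injective {x | castVec x ∈ S} (add_right_injective w)]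
  congr 1
  ext x
  simp only [Set.mem_ofPred_eq, Set.mem_image, Set.mem_vadd_set, vadd_eq_add]
  constructor
  · rintro ⟨y, hy, hyx⟩
    have h : castVec (x - w) = y := by rw [castVec_sub, ← hyx, add_sub_cancel_left]
    exact ⟨x - w, h ▸ hy, add_sub_cancel w x⟩
  · rintro ⟨y, hy, rfl⟩
    exact ⟨castVec y, hy, (castVec_add w y).symm⟩

/-- Lattice point counts of translates are controlled by those of larger dilates. -/
lemma exists_latCount_vadd_le (hP : Convex ℝ P) (hPc : IsCompact P) (hint : (interior P).Nonempty) :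
    ∃ k : ℕ, ∀ (b c : Fin d → ℝ) (t : ℕ),
      latCount (b +ᵥ (t : ℝ) • P) ≤ latCount (c +ᵥ ((t + k : ℕ) : ℝ) • P) := by
  obtain ⟨k, hk⟩ := exists_forall_exists_castVec_add_mem_smul hint
  refine ⟨k, fun b c t => ?_⟩
  obtain ⟨w, hw⟩ := hk (b - c)
  rw [← latCount_castVec_vadd w]
  refine latCount_mono ((hPc.smul _).isBounded.vadd c) ?_
  rw [Nat.cast_add, hP.add_smul (Nat.cast_nonneg t) (Nat.cast_nonneg k)]
  rintro _ ⟨_, ⟨x, hx, rfl⟩, rfl⟩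
  refine ⟨x + (b - c + castVec w), Set.add_mem_add hx hw, ?_⟩
  simp only [vadd_eq_add]
  abel

end Volume

/-- For a full-dimensional lattice polytope `P ⊂ ℝ^d` and any `c ∈ ℝ^d`,
the translated lattice point enumerator `t ↦ #((c + tP) ∩ ℤ^d)` agrees with a
polynomial of degree `d` with leading coefficient `vol_d(P)`. -/
theorem translated_lattice_point_enumerator_polynomial_full_dim
    (d : ℕ) (P : Set (Fin d → ℝ)) (hP : IsLatticePolytope P)
    (hdim : affineSpan ℝ P = ⊤) (c : Fin d → ℝ) :
    ∃ f : Polynomial ℚ, f.natDegree = d ∧ (f.leadingCoeff : ℝ) = (volume P).toReal ∧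
      ∀ t : ℕ, 0 < t → (latCount (c +ᵥ (t : ℝ) • P) : ℚ) = f.eval (t : ℚ) := by
  obtain ⟨V, -, hV⟩ := id hP
  have hconv : Convex ℝ P := hV ▸ convex_convexHull ℝ _
  have hcomp : IsCompact P := hV ▸ (V.finite_toSet.image castVec).isCompact_convexHull ℝ
  have hint := hconv.interior_nonempty_iff_affineSpan_eq_top.2 hdim
  have hvol : 0 < (volume P).toReal := ENNReal.toReal_pos
    (Measure.measure_pos_of_nonempty_interior volume hint).ne' hcomp.measure_lt_top.ne
  obtain ⟨f, hf⟩ := hP.exists_poly_latCount c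
  obtain ⟨g, hg⟩ := hP.exists_poly_latCount 0
  obtain ⟨k, hk⟩ := exists_latCount_vadd_le hconv hcomp hint
  have heval : ∀ (q : ℚ[X]) (t : ℕ), (q.map (algebraMap ℚ ℝ)).eval (t : ℝ) = (q.eval (t : ℚ) : ℚ) :=
    fun q t => by
      rw [← map_natCast (algebraMap ℚ ℝ), eval_map_apply]; rfl
  have hf' : ∀ t : ℕ, 0 < t → (f.map (algebraMap ℚ ℝ)).eval (t : ℝ) =
      latCount (c +ᵥ (t : ℝ) • P) := fun t ht => by
    rw [heval, ← hf t ht, Rat.cast_natCast]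
  have hg' : ∀ t : ℕ, 0 < t → (g.map (algebraMap ℚ ℝ)).eval (t : ℝ) =
      latCount ((0 : Fin d → ℝ) +ᵥ (t : ℝ) • P) := fun t ht => by
    rw [heval, ← hg t ht, Rat.cast_natCast]
  set F := f.map (algebraMap ℚ ℝ) with hF
  set G := g.map (algebraMap ℚ ℝ)
  have hcomp_X : ∀ (q : ℝ[X]) (m t : ℕ), (q.comp (X + C (m : ℝ))).eval (t : ℝ) =
      q.eval ((t + m : ℕ) : ℝ) := fun q m t => by simp
  have hGlim : Tendsto (fun t : ℕ => G.eval (t : ℝ) / t ^ d) atTop (𝓝 (volume P).toReal) := by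
    refine (tendsto_latCount_div_pow hconv hcomp).congr' ?_
    filter_upwards [eventually_gt_atTop 0] with t ht
    rw [hg' t ht, zero_vadd]
  obtain ⟨hGd, hGl⟩ := natDegree_eq_of_tendsto_div_pow hvol hGlim
  have hdeg : ∀ (q : ℝ[X]) (m : ℕ), (q.comp (X + C (m : ℝ))).natDegree = q.natDegree ∧
      (q.comp (X + C (m : ℝ))).leadingCoeff = q.leadingCoeff := fun q m =>
    ⟨by rw [natDegree_comp, natDegree_X_add_C, mul_one],
      by rw [leadingCoeff_comp (by rw [natDegree_X_add_C]; exact one_ne_zero),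
        leadingCoeff_X_add_C, one_pow, mul_one]⟩
  have hG'lim : Tendsto (fun t : ℕ => (G.comp (X + C ((k + k : ℕ) : ℝ))).eval (t : ℝ) / t ^ d)
      atTop (𝓝 (volume P).toReal) := by
    have hne : G.comp (X + C ((k + k : ℕ) : ℝ)) ≠ 0 := by
      rw [← leadingCoeff_ne_zero, (hdeg G _).2, hGl]
      exact hvol.ne'
    have := tendsto_eval_div_pow_natDegree hne
    rwa [(hdeg G _).1, (hdeg G _).2, hGl, hGd] at this
  have hFlim : Tendsto (fun t : ℕ => (F.comp (X + C (k : ℝ))).eval (t : ℝ) / t ^ d) atTop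
      (𝓝 (volume P).toReal) := by
    refine tendsto_of_tendsto_of_tendsto_of_le_of_le' hGlim hG'lim ?_ ?_
    · filter_upwards [eventually_gt_atTop 0] with t ht
      rw [hcomp_X, hg' t ht, hf' _ (by omega)]
      gcongr
      exact hk 0 c t
    · filter_upwards [eventually_gt_atTop 0] with t ht
      rw [hcomp_X, hcomp_X, hg' _ (by omega), hf' _ (by omega), ← add_assoc]
      gcongr
      exact hk c 0 (t + k)
  obtain ⟨hFd, hFl⟩ := natDegree_eq_of_tendsto_div_pow hvol hFlim
  rw [(hdeg F k).1] at hFd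
  rw [(hdeg F k).2] at hFl
  refine ⟨f, ?_, ?_, hf⟩
  · rw [← hFd, hF, natDegree_map]
  · rw [← hFl, hF, leadingCoeff_map]
    rfl
end
end
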